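/- Let D be a finite acyclic digraph on n vertices in which every vertex has out-degree at most 1 (i.e., a union of vertex-disjoint in-arborescences) and in which every vertex has in-degree at most Δ. Then for every integer s ≥ 2 there exists a set F of arcs of D with |F| ≤ Δ·⌈n/(s−1)⌉ such that every weakly connected component of D − F has at most s vertices. -/

import Mathlib

theorem stmt15_rmono {V : Type*} {R P : V → V → Prop} (h : ∀ a b, R a b → P a b) {x y : V}
    (hxy : Relation.ReflTransGen R x y) : Relation.ReflTransGen P x y :=
  Relation.ReflTransGen.mono h _ _ hxy

theorem stmt15_tmono {V : Type*} {R P : V → V → Prop} (h : ∀ a b, R a b → P a b) {x y : V}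
    (hxy : Relation.TransGen R x y) : Relation.TransGen P x y :=
  Relation.TransGen.mono h _ _ hxy

open Relation in
theorem stmt15_aux {V : Type*} [Fintype V] [DecidableEq V] (A : V → V → Prop)
    (hacyc : ∀ v : V, ¬ Relation.TransGen A v v)
    (hfun : ∀ u a b : V, A u a → A u b → a = b)
    (s : ℕ) (hs : 2 ≤ s) (n : ℕ) : ∀ S : Finset V, S.card = n →
    ∃ C : Finset V, C.card * (s - 1) ≤ S.card ∧
      ∀ w ∈ S, ({u : V | ReflTransGen
        (fun a b => A a b ∧ a ∈ S ∧ b ∈ S ∧ b ∉ C) u w}).ncard ≤ s - 1 := by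
  classical
  induction n using Nat.strong_induction_on with
  | _ n ih =>
  intro S hSn
  set R : V → V → Prop := fun a b => A a b ∧ a ∈ S ∧ b ∈ S with hR
  let d : V → ℕ := fun w => ({u : V | ReflTransGen R u w}).ncard
  by_cases hbig : ∃ v, v ∈ S ∧ s ≤ d v
  swap
  · push Not at hbig
    refine ⟨∅, by simp, fun w hw => ?_⟩
    have h1 := hbig w hw
    have h2 : ({u : V | ReflTransGen (fun a b => A a b ∧ a ∈ S ∧ b ∈ S ∧ b ∉ (∅ : Finset V)) u w}).ncard ≤ d w := by
      apply Set.ncard_le_ncard _ (Set.toFinite _)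
      intro u hu
      exact stmt15_rmono (fun a b h => ⟨h.1, h.2.1, h.2.2.1⟩) hu
    omega
  · obtain ⟨v, hv, hmin⟩ := Finset.exists_min_image (Finset.univ.filter (fun v => v ∈ S ∧ s ≤ d v)) d
      (by obtain ⟨v, hv⟩ := hbig; exact ⟨v, by simpa using hv⟩)
    simp only [Finset.mem_filter, Finset.mem_univ, true_and] at hv hmin
    obtain ⟨hvS, hvs⟩ := hv
    let T : Finset V := Finset.univ.filter (fun u => TransGen R u v)
    have hT : ∀ u, u ∈ T ↔ TransGen R u v := by simp [T]
    have hTS : T ⊆ S := by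
      intro u hu
      rw [hT] at hu
      obtain ⟨b, hb, -⟩ := TransGen.head'_iff.1 hu
      exact hb.2.1
    have hRA : ∀ a b, TransGen R a b → TransGen A a b := fun a b h =>
      stmt15_tmono (fun _ _ h => h.1) h
    have hvT : v ∉ T := fun h => hacyc v (hRA _ _ ((hT v).1 h))
    have hdv : d v = T.card + 1 := by
      have : {u : V | ReflTransGen R u v} = ((insert v T : Finset V) : Set V) := by
        ext u
        simp only [Set.mem_ofPred_eq, Finset.coe_insert, Set.mem_insert_iff, Finset.mem_coe, hT]
        rw [reflTransGen_iff_eq_or_transGen]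
        simp [eq_comm]
      show ({u : V | ReflTransGen R u v}).ncard = _
      rw [this, Set.ncard_coe_finset, Finset.card_insert_of_notMem hvT]
    have hcard : (S \ T).card + T.card = S.card := Finset.card_sdiff_add_card_eq_card hTS
    obtain ⟨C, hC1, hC2⟩ := ih (S \ T).card (by omega) (S \ T) rfl
    refine ⟨insert v C, ?_, ?_⟩
    · have := Finset.card_insert_le v C
      calc (insert v C).card * (s - 1) ≤ (C.card + 1) * (s - 1) := Nat.mul_le_mul_right _ this
        _ = C.card * (s - 1) + (s - 1) := by ring
        _ ≤ S.card := by omega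
    · intro w hw
      by_cases hwT : w ∈ T
      · have h2 : ({u : V | ReflTransGen (fun a b => A a b ∧ a ∈ S ∧ b ∈ S ∧ b ∉ insert v C) u w}).ncard ≤ d w := by
          apply Set.ncard_le_ncard _ (Set.toFinite _)
          intro u hu
          exact stmt15_rmono (fun a b h => ⟨h.1, h.2.1, h.2.2.1⟩) hu
        have h3 : d w < d v := by
          apply Set.ncard_lt_ncard _ (Set.toFinite _)
          refine ⟨fun u hu => ?_, fun h => ?_⟩
          · exact ReflTransGen.trans hu ((hT w).1 hwT).to_reflTransGen
          · have : ReflTransGen R v w := h (show ReflTransGen R v v from .refl)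
            exact hacyc v (hRA _ _ (TransGen.trans_right this ((hT w).1 hwT)))
        have h4 : ¬ s ≤ d w := fun h => by
          have := hmin w ⟨hw, h⟩
          omega
        omega
      · have hw' : w ∈ S \ T := Finset.mem_sdiff.2 ⟨hw, hwT⟩
        refine le_trans (Set.ncard_le_ncard ?_ (Set.toFinite _)) (hC2 w hw')
        intro u hu
        have key : u ∈ S \ T ∧ ReflTransGen
          (fun a b => A a b ∧ a ∈ S \ T ∧ b ∈ S \ T ∧ b ∉ C) u w := by
          have hu' : ReflTransGen (fun a b => A a b ∧ a ∈ S ∧ b ∈ S ∧ b ∉ insert v C) u w := hu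
          induction hu' using ReflTransGen.head_induction_on with
          | refl => exact ⟨hw', .refl⟩
          | head hab hb ihb =>
            rename_i a b
            obtain ⟨hbS, hbw⟩ := ihb hb
            obtain ⟨h1, h2, h3, h4⟩ := hab
            rw [Finset.mem_insert, not_or] at h4
            have haT : a ∉ T := by
              intro haT
              obtain ⟨c, hc, hcv⟩ := TransGen.head'_iff.1 ((hT a).1 haT)
              have : c = b := hfun a c b hc.1 h1
              subst this
              rcases reflTransGen_iff_eq_or_transGen.1 hcv with h | h
              · exact h4.1 h.symm
              · exact (Finset.mem_sdiff.1 hbS).2 ((hT c).2 h)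
            have haS : a ∈ S \ T := Finset.mem_sdiff.2 ⟨h2, haT⟩
            exact ⟨haS, .head ⟨h1, haS, hbS, h4.2⟩ hbw⟩
        exact key.2

open Relation in
theorem stmt15_root {V : Type*} [Fintype V] (R : V → V → Prop)
    (hacyc : ∀ v : V, ¬ TransGen R v v) (v : V) :
    ∃ w, ReflTransGen R v w ∧ ∀ x, ¬ R w x := by
  classical
  obtain ⟨w, hw, hmin⟩ := Finset.exists_min_image
    (Finset.univ.filter (fun w => ReflTransGen R v w))
    (fun w => ({u : V | TransGen R w u}).ncard) ⟨v, by simp [ReflTransGen.refl]⟩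
  simp only [Finset.mem_filter, Finset.mem_univ, true_and] at hw hmin
  refine ⟨w, hw, fun x hx => ?_⟩
  have h1 := hmin x (hw.tail hx)
  have h2 : ({u : V | TransGen R x u}).ncard < ({u : V | TransGen R w u}).ncard := by
    apply Set.ncard_lt_ncard _ (Set.toFinite _)
    refine ⟨fun u hu => TransGen.head hx hu, fun h => ?_⟩
    exact hacyc x (h (show TransGen R w x from .single hx))
  omega

open Relation in
theorem stmt15_comp {V : Type*} [Fintype V] (R : V → V → Prop)
    (hacyc : ∀ v : V, ¬ TransGen R v v) (hfun : ∀ u a b : V, R u a → R u b → a = b) (v : V) :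
    ∃ w, ∀ u, ReflTransGen (fun a b => R a b ∨ R b a) v u → ReflTransGen R u w := by
  obtain ⟨w, hw, hterm⟩ := stmt15_root R hacyc v
  refine ⟨w, fun u hu => ?_⟩
  induction hu with
  | refl => exact hw
  | tail _ hbc ihb =>
    rcases hbc with h | h
    · rcases ReflTransGen.cases_head ihb with h' | ⟨c, hc, hcw⟩
      · subst h'
        exact absurd h (hterm _)
      · rw [hfun _ _ _ h hc]
        exact hcw
    · exact .head h ihb


/-- Let `D` be a finite acyclic digraph on `n` vertices (arc relation `A`, with
acyclicity expressed as the absence of directed closed walks, i.e. the transitive closure of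
`A` is irreflexive) in which every vertex has out-degree at most 1 and in-degree at most `Δ`.
Then for every integer `s ≥ 2` there exists a set `F` of arcs of `D` with
`|F| ≤ Δ · ⌈n / (s-1)⌉` such that every weakly connected component of `D - F` (a connected
component of the underlying undirected graph after deleting the arcs in `F`) has at most `s`
vertices. -/
theorem stmt_15 {V : Type*} [Fintype V] (A : V → V → Prop)
    (hacyc : ∀ v : V, ¬ Relation.TransGen A v v)
    (hout : ∀ u : V, ({v : V | A u v}).ncard ≤ 1)
    (Δ : ℕ) (hin : ∀ v : V, ({u : V | A u v}).ncard ≤ Δ)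
    (s : ℕ) (hs : 2 ≤ s) :
    ∃ F : Set (V × V),
      (∀ a ∈ F, A a.1 a.2) ∧
      F.ncard ≤ Δ * ⌈(Fintype.card V : ℝ) / ((s : ℝ) - 1)⌉₊ ∧
      ∀ v : V,
        ({u : V | Relation.ReflTransGen
            (fun a b => (A a b ∧ (a, b) ∉ F) ∨ (A b a ∧ (b, a) ∉ F)) v u}).ncard ≤ s := by

  classical
  have hfun : ∀ u a b : V, A u a → A u b → a = b := fun u a b ha hb =>
    (Set.ncard_le_one (Set.toFinite _)).1 (hout u) a ha b hb
  obtain ⟨C, hC1, hC2⟩ := stmt15_aux A hacyc hfun s hs _ Finset.univ rfl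
  refine ⟨{a | A a.1 a.2 ∧ a.2 ∈ C}, fun a ha => ha.1, ?_, fun v => ?_⟩
  · have h1 : C.card ≤ ⌈(Fintype.card V : ℝ) / ((s : ℝ) - 1)⌉₊ := by
      have hs' : (0 : ℝ) < (s : ℝ) - 1 := by
        have : (2 : ℝ) ≤ s := by exact_mod_cast hs
        linarith
      have h2 : (C.card : ℝ) ≤ (Fintype.card V : ℝ) / ((s : ℝ) - 1) := by
        rw [le_div_iff₀ hs']
        have h3 : ((C.card * (s - 1) : ℕ) : ℝ) ≤ (Fintype.card V : ℝ) := by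
          exact_mod_cast hC1
        rwa [Nat.cast_mul, Nat.cast_sub (by omega), Nat.cast_one] at h3
      exact_mod_cast h2.trans (Nat.le_ceil _)
    refine le_trans ?_ (Nat.mul_le_mul_left Δ h1)
    have h4 : {a : V × V | A a.1 a.2 ∧ a.2 ∈ C} =
        ((C.biUnion (fun b => (Finset.univ.filter (fun u => A u b)).image (fun u => (u, b))) :
          Finset (V × V)) : Set (V × V)) := by
      ext ⟨a, b⟩
      simp
    rw [h4, Set.ncard_coe_finset, mul_comm]
    apply Finset.card_biUnion_le_card_mul
    intro b _
    refine Finset.card_image_le.trans ?_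
    have h5 := hin b
    rw [← Set.ncard_coe_finset]
    simpa using h5
  · obtain ⟨w, hw⟩ := stmt15_comp (fun a b => A a b ∧ b ∉ C)
      (fun v h => hacyc v (stmt15_tmono (fun _ _ h => h.1) h))
      (fun u a b ha hb => hfun u a b ha.1 hb.1) v
    have h6 := hC2 w (Finset.mem_univ w)
    refine le_trans (Set.ncard_le_ncard ?_ (Set.toFinite _)) (h6.trans (Nat.sub_le s 1))
    intro u hu
    refine stmt15_rmono ?_ (hw u (stmt15_rmono ?_ hu))
    · intro a b h
      exact ⟨h.1, Finset.mem_univ _, Finset.mem_univ _, h.2⟩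
    · rintro a b (⟨h, h'⟩ | ⟨h, h'⟩)
      · exact Or.inl ⟨h, fun hc => h' ⟨h, hc⟩⟩
      · exact Or.inr ⟨h, fun hc => h' ⟨h, hc⟩⟩
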